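/- For the once-integrated Wiener process with σ² = 1, the posterior covariance after observing x(t₀) = x₀ and ẋ(t₀) = y₁ satisfies, for t = t₀ + s and t' = t₀ + s' with 0 < s' ≤ s, k_{|x₀,y₁}(t, t') = (t₀−t')²(3t−t'−2t₀)/6 = s'²(3s − s')/6; and for t > t₀ ≥ t' it equals 0. -/

import Mathlib

open Matrix

/-- Once-integrated Wiener covariance with `σ² = 1`. -/
noncomputable def k1 (t t' : ℝ) : ℝ := (min t t') ^ 3 / 3 + |t - t'| * (min t t') ^ 2 / 2

/-- Partial derivative of `k1` in its second argument. -/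
noncomputable def d2k1 (t t' : ℝ) : ℝ := if t < t' then t ^ 2 / 2 else t * t' - t' ^ 2 / 2

/-- Posterior covariance of the once-integrated Wiener GP after observing
    `x(t₀)` and `ẋ(t₀)`. -/
noncomputable def postCov (t0 t t' : ℝ) : ℝ :=
  k1 t t' -
    ![k1 t t0, d2k1 t t0] ⬝ᵥ
      ((!![t0 ^ 3 / 3, t0 ^ 2 / 2; t0 ^ 2 / 2, t0])⁻¹ *ᵥ ![k1 t0 t', d2k1 t' t0])

lemma k1_of_le {a b : ℝ} (h : b ≤ a) : k1 a b = b ^ 3 / 3 + (a - b) * b ^ 2 / 2 := by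
  rw [k1, min_eq_right h, abs_of_nonneg (sub_nonneg.2 h)]

lemma k1_of_le' {a b : ℝ} (h : a ≤ b) : k1 a b = a ^ 3 / 3 + (b - a) * a ^ 2 / 2 := by
  rw [k1, min_eq_left h, abs_sub_comm, abs_of_nonneg (sub_nonneg.2 h)]

/-- For `t = t₀ + s` with `s ≥ 0` the row vector is `[1, s] K`. -/
lemma postCov_eq (t0 s t' : ℝ) (ht0 : 0 < t0) (hs : 0 ≤ s) :
    postCov t0 (t0 + s) t' = k1 (t0 + s) t' - (k1 t0 t' + s * d2k1 t' t0) := by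
  have hdet : IsUnit (!![t0 ^ 3 / 3, t0 ^ 2 / 2; t0 ^ 2 / 2, t0]).det := by
    rw [Matrix.det_fin_two_of, isUnit_iff_ne_zero]
    have : 0 < t0 ^ 4 := by positivity
    nlinarith
  have hrow : ![k1 (t0 + s) t0, d2k1 (t0 + s) t0] =
      ![1, s] ᵥ* !![t0 ^ 3 / 3, t0 ^ 2 / 2; t0 ^ 2 / 2, t0] := by
    rw [k1_of_le (by linarith), d2k1, if_neg (by linarith)]
    ext i
    fin_cases i <;> simp [Matrix.vecMul, dotProduct, Fin.sum_univ_two] <;> ring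
  rw [postCov, hrow, Matrix.dotProduct_mulVec, Matrix.vecMul_vecMul,
    Matrix.mul_nonsing_inv _ hdet, Matrix.vecMul_one]
  simp [dotProduct, Fin.sum_univ_two]

/-- The once-integrated Wiener posterior covariance at `(t₀+s, t₀+s')` equals
    `s'²(3s − s')/6` for `0 < s' ≤ s`, and `0` for `t₀ + s > t₀ ≥ t₀ + s'`. -/
theorem onceIntegratedWiener_postCov (t0 s s' : ℝ) (ht0 : 0 < t0) :
    (0 < s' → s' ≤ s → postCov t0 (t0 + s) (t0 + s') = s' ^ 2 * (3 * s - s') / 6) ∧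
    (0 < t0 + s' → s' ≤ 0 → 0 < s → postCov t0 (t0 + s) (t0 + s') = 0) := by
  constructor
  · intro h1 h2
    rw [postCov_eq _ _ _ ht0 (by linarith), k1_of_le (by linarith), k1_of_le' (by linarith),
      d2k1, if_neg (by linarith)]
    ring
  · intro h0 h1 h2
    rw [postCov_eq _ _ _ ht0 h2.le, k1_of_le (by linarith), k1_of_le (by linarith), d2k1]
    split_ifs with h
    · ring
    · have : s' = 0 := by linarith
      subst this
      ring
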